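/- Let P = ⟨A | R⟩ be any finite presentation. There is a constant C > 0, depending only on P, such that every null-homotopic word w satisfies FL(w) ≤ C·Area(w) + ℓ(w): if w is equal in the free group on A to a product of N conjugates of elements of R ∪ R⁻¹, then w can be converted to the empty word by free reductions, free expansions and applications of relators with every intermediate word of length at most C·N + ℓ(w). -/

import Mathlib

/-! Words over an alphabet `A`: a letter `(x, true)` is the generator `x`,
and `(x, false)` is its formal inverse `x⁻¹`. -/

/-- A word over the alphabet `A ∪ A⁻¹`. -/
abbrev Word (A : Type*) := List (A × Bool)

namespace Word

/-- The formal inverse of a word. -/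
def inv {A : Type*} (w : Word A) : Word A := (w.map fun p => (p.1, !p.2)).reverse

/-- `w'` is a cyclic conjugate (cyclic permutation) of `w`. -/
def IsCyclicConj {A : Type*} (w w' : Word A) : Prop :=
  ∃ u v : Word A, w = u ++ v ∧ w' = v ++ u

end Word

/-- Moves (i)–(iii) on words with respect to a set `R` of relator words:
free reduction, free expansion, and application of a relator (replace a subword `u`
by `v` where some cyclic conjugate of `u * v⁻¹` lies in `R ∪ R⁻¹`). -/
inductive Move {A : Type*} (R : Set (Word A)) : Word A → Word A → Prop
  | freeReduce (u v : Word A) (x : A) (b : Bool) :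
      Move R (u ++ (x, b) :: (x, !b) :: v) (u ++ v)
  | freeExpand (u v : Word A) (x : A) (b : Bool) :
      Move R (u ++ v) (u ++ (x, b) :: (x, !b) :: v)
  | relator (p q u v z : Word A)
      (hz : Word.IsCyclicConj (u ++ Word.inv v) z) (hR : z ∈ R ∨ Word.inv z ∈ R) :
      Move R (p ++ u ++ q) (p ++ v ++ q)

/-- Moves (i)–(iv): moves (i)–(iii) together with cyclic conjugation. -/
inductive MoveC {A : Type*} (R : Set (Word A)) : Word A → Word A → Prop
  | of {w w' : Word A} : Move R w w' → MoveC R w w'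
  | cyc {w w' : Word A} : Word.IsCyclicConj w w' → MoveC R w w'

/-- Moves (i)–(v) on finite sequences of words: one of the moves (i)–(iv) applied to
one word of the sequence, or fragmentation of one word `u ++ v` into `u` and `v`. -/
inductive MoveF {A : Type*} (R : Set (Word A)) : List (Word A) → List (Word A) → Prop
  | of (l₁ l₂ : List (Word A)) {w w' : Word A} :
      MoveC R w w' → MoveF R (l₁ ++ w :: l₂) (l₁ ++ w' :: l₂)
  | frag (l₁ l₂ : List (Word A)) (u v : Word A) :
      MoveF R (l₁ ++ (u ++ v) :: l₂) (l₁ ++ u :: v :: l₂)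

/-- A word is null-homotopic over the presentation with relator set `R` if it represents
the identity of the presented group, i.e. lies in the normal closure of the relators. -/
def NullHomotopic {A : Type*} (R : Set (Word A)) (w : Word A) : Prop :=
  FreeGroup.mk w ∈ Subgroup.normalClosure (FreeGroup.mk '' R)

/-- `FLle R w L`: the word `w` can be converted to the empty word by moves (i)–(iii)
with every intermediate word of length at most `L`. -/
def FLle {A : Type*} (R : Set (Word A)) (w : Word A) (L : ℕ) : Prop :=
  ∃ (m : ℕ) (f : ℕ → Word A), f 0 = w ∧ f m = [] ∧
    (∀ i < m, Move R (f i) (f (i + 1))) ∧ ∀ i ≤ m, (f i).length ≤ L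

/-- `FFLle R w L`: the word `w` can be converted to the empty word by moves (i)–(iv)
with every intermediate word of length at most `L`. -/
def FFLle {A : Type*} (R : Set (Word A)) (w : Word A) (L : ℕ) : Prop :=
  ∃ (m : ℕ) (f : ℕ → Word A), f 0 = w ∧ f m = [] ∧
    (∀ i < m, MoveC R (f i) (f (i + 1))) ∧ ∀ i ≤ m, (f i).length ≤ L

/-- The total length of a finite sequence of words. -/
def totalLength {A : Type*} (l : List (Word A)) : ℕ := (l.map List.length).sum

/-- `FFFLle R w L`: the length-one sequence `(w)` can be converted to a sequence of empty
words by moves (i)–(v) with every intermediate sequence of total length at most `L`. -/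
def FFFLle {A : Type*} (R : Set (Word A)) (w : Word A) (L : ℕ) : Prop :=
  ∃ (m : ℕ) (f : ℕ → List (Word A)), f 0 = [w] ∧ (∀ u ∈ f m, u = ([] : Word A)) ∧
    (∀ i < m, MoveF R (f i) (f (i + 1))) ∧ ∀ i ≤ m, totalLength (f i) ≤ L

/-- An element `x` of the free group is a conjugate of a relator of `R` or of an inverse
of a relator. -/
def IsConjRelator {A : Type*} (R : Set (Word A)) (x : FreeGroup A) : Prop :=
  ∃ c ρ : FreeGroup A, (ρ ∈ FreeGroup.mk '' R ∨ ρ⁻¹ ∈ FreeGroup.mk '' R) ∧ x = c * ρ * c⁻¹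

/-- `AreaLe R g N`: in the free group, `g` is a product of at most `N` conjugates
of elements of `R ∪ R⁻¹`. -/
def AreaLe {A : Type*} (R : Set (Word A)) (g : FreeGroup A) (N : ℕ) : Prop :=
  ∃ l : List (FreeGroup A), l.length ≤ N ∧ (∀ x ∈ l, IsConjRelator R x) ∧ l.prod = g

/-- The number of occurrences in `w` of the letter `x` or its inverse. -/
def countLtr {A : Type*} [DecidableEq A] (x : A) (w : Word A) : ℕ :=
  (w.filter fun p => p.1 = x).length

/-- The filling length `FL(w)` of a null-homotopic word. -/
noncomputable def FLw {A : Type*} (R : Set (Word A)) (w : Word A) : ℕ :=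
  sInf {L | FLle R w L}

/-- The free filling length `FFL(w)` of a null-homotopic word. -/
noncomputable def FFLw {A : Type*} (R : Set (Word A)) (w : Word A) : ℕ :=
  sInf {L | FFLle R w L}

/-- The fragmenting free filling length `FFFL(w)` of a null-homotopic word. -/
noncomputable def FFFLw {A : Type*} (R : Set (Word A)) (w : Word A) : ℕ :=
  sInf {L | FFFLle R w L}

/-- The filling length function `FL : ℕ → ℕ` of the presentation with relators `R`. -/
noncomputable def FLfn {A : Type*} (R : Set (Word A)) (n : ℕ) : ℕ :=
  sSup (FLw R '' {w | NullHomotopic R w ∧ w.length ≤ n})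

/-- The free filling length function `FFL : ℕ → ℕ`. -/
noncomputable def FFLfn {A : Type*} (R : Set (Word A)) (n : ℕ) : ℕ :=
  sSup (FFLw R '' {w | NullHomotopic R w ∧ w.length ≤ n})

/-- The fragmenting free filling length function `FFFL : ℕ → ℕ`. -/
noncomputable def FFFLfn {A : Type*} (R : Set (Word A)) (n : ℕ) : ℕ :=
  sSup (FFFLw R '' {w | NullHomotopic R w ∧ w.length ≤ n})

/-! The presentation `Q = ⟨a, b, r, s, t | a^b a⁻², [t,a], [r,at], [r,s], [s,t]⟩`. -/

/-- The five generators of the presentation `Q`. -/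
inductive QGen | a | b | r | s | t
deriving DecidableEq

/-- The five relators of `Q`: `b⁻¹aba⁻¹a⁻¹`, `t⁻¹a⁻¹ta`, `r⁻¹t⁻¹a⁻¹rat`,
`r⁻¹s⁻¹rs`, `s⁻¹t⁻¹st`. -/
def QRels : Set (Word QGen) :=
  { [(QGen.b, false), (QGen.a, true), (QGen.b, true), (QGen.a, false), (QGen.a, false)],
    [(QGen.t, false), (QGen.a, false), (QGen.t, true), (QGen.a, true)],
    [(QGen.r, false), (QGen.t, false), (QGen.a, false), (QGen.r, true), (QGen.a, true),
      (QGen.t, true)],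
    [(QGen.r, false), (QGen.s, false), (QGen.r, true), (QGen.s, true)],
    [(QGen.s, false), (QGen.t, false), (QGen.s, true), (QGen.t, true)] }

/-- The word `bⁿ`. -/
def bpow (n : ℕ) : Word QGen := List.replicate n (QGen.b, true)

/-- The word `b⁻ⁿ`. -/
def bpowInv (n : ℕ) : Word QGen := List.replicate n (QGen.b, false)

/-- The word `a^{-bⁿ} = b⁻ⁿ a⁻¹ bⁿ`. -/
def aConjNeg (n : ℕ) : Word QGen := bpowInv n ++ [(QGen.a, false)] ++ bpow n

/-- The word `a^{bⁿ} = b⁻ⁿ a bⁿ`. -/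
def aConjPos (n : ℕ) : Word QGen := bpowInv n ++ [(QGen.a, true)] ++ bpow n

/-- The word `a^{-bⁿ} r a^{bⁿ}`. -/
def gword (n : ℕ) : Word QGen := aConjNeg n ++ [(QGen.r, true)] ++ aConjPos n

/-- The word `w_n = [s, a^{-bⁿ} r a^{bⁿ}] = s⁻¹ (b⁻ⁿa⁻¹bⁿ r b⁻ⁿabⁿ)⁻¹ s (b⁻ⁿa⁻¹bⁿ r b⁻ⁿabⁿ)`. -/
def wn (n : ℕ) : Word QGen :=
  [(QGen.s, false)] ++ Word.inv (gword n) ++ [(QGen.s, true)] ++ gword n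

/-- The word `a^{-bⁿ} r a^{bⁿ} r a^{bⁿ} r⁻¹ a^{-bⁿ}`. -/
def g'word (n : ℕ) : Word QGen :=
  aConjNeg n ++ [(QGen.r, true)] ++ aConjPos n ++ [(QGen.r, true)] ++ aConjPos n ++
    [(QGen.r, false)] ++ aConjNeg n

/-- The word `w'_n = [s, a^{-bⁿ} r a^{bⁿ} r a^{bⁿ} r⁻¹ a^{-bⁿ}]`. -/
def w'n (n : ℕ) : Word QGen :=
  [(QGen.s, false)] ++ Word.inv (g'word n) ++ [(QGen.s, true)] ++ g'word n

namespace Word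

variable {A : Type*}

@[simp] theorem inv_nil : inv ([] : Word A) = [] := rfl

theorem inv_eq_invRev (w : Word A) : inv w = FreeGroup.invRev w := rfl

@[simp] theorem inv_inv (w : Word A) : inv (inv w) = w := FreeGroup.invRev_invRev

@[simp] theorem length_inv (w : Word A) : (inv w).length = w.length := by
  simp [inv]

theorem inv_append (u v : Word A) : inv (u ++ v) = inv v ++ inv u := by
  simp [inv]

theorem inv_cons (x : A) (b : Bool) (w : Word A) : inv ((x, b) :: w) = inv w ++ [(x, !b)] := by
  simp [inv]

/-- `z` is a cyclic conjugate of a relator or of the inverse of a relator. -/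
def IsRel (R : Set (Word A)) (z : Word A) : Prop :=
  ∃ r, IsCyclicConj z r ∧ (r ∈ R ∨ inv r ∈ R)

theorem IsRel.rotate {R : Set (Word A)} {u v : Word A} (h : IsRel R (u ++ v)) :
    IsRel R (v ++ u) := by
  obtain ⟨r, ⟨p, q, h1, rfl⟩, hr⟩ := h
  rcases List.append_eq_append_iff.1 h1 with ⟨t, rfl, rfl⟩ | ⟨t, rfl, rfl⟩
  · exact ⟨q ++ (u ++ t), ⟨t, q ++ u, by simp, by simp⟩, hr⟩
  · exact ⟨t ++ v ++ p, ⟨v ++ p, t, by simp, by simp⟩, hr⟩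

theorem IsRel.inv {R : Set (Word A)} {z : Word A} (h : IsRel R z) : IsRel R (Word.inv z) := by
  obtain ⟨r, ⟨p, q, rfl, rfl⟩, hr⟩ := h
  exact ⟨Word.inv (q ++ p), ⟨Word.inv q, Word.inv p, inv_append _ _, inv_append _ _⟩, by
    rw [inv_inv]; exact hr.symm⟩

theorem isRel_of_mem {R : Set (Word A)} {z : Word A} (h : z ∈ R) : IsRel R z :=
  ⟨z, ⟨[], z, rfl, by simp⟩, Or.inl h⟩

/-- `Fills R w N`: the word `w` can be reduced to the empty word by free reductions and at
most `N` insertions of cyclic conjugates of relators or of their inverses. -/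
inductive Fills (R : Set (Word A)) : Word A → ℕ → Prop
  | nil (N : ℕ) : Fills R [] N
  | cancel (u v : Word A) (x : A) (b : Bool) {N : ℕ} :
      Fills R (u ++ v) N → Fills R (u ++ (x, b) :: (x, !b) :: v) N
  | insert (u z v : Word A) {N : ℕ} : IsRel R z →
      Fills R (u ++ (z ++ v)) N → Fills R (u ++ v) (N + 1)

namespace Fills

variable {R : Set (Word A)}

theorem mono {w : Word A} {N M : ℕ} (h : Fills R w N) (hNM : N ≤ M) : Fills R w M := by
  induction h generalizing M with
  | nil N => exact .nil M
  | cancel u v x b _ ih => exact .cancel u v x b (ih hNM)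
  | insert u z v hz _ ih =>
    obtain ⟨M, rfl⟩ : ∃ k, M = k + 1 := ⟨M - 1, by omega⟩
    exact .insert u z v hz (ih (by omega))

theorem insert_middle {u v y : Word A} {N M : ℕ} (hy : Fills R y M) (h : Fills R (u ++ v) N) :
    Fills R (u ++ (y ++ v)) (N + M) := by
  induction hy with
  | nil M => exact h.mono (by omega)
  | cancel p q x b _ ih =>
    have := Fills.cancel (u ++ p) (q ++ v) x b (by simpa using ih)
    simpa using this
  | insert p z q hz _ ih =>
    have := Fills.insert (u ++ p) z (q ++ v) hz (by simpa using ih)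
    simpa [Nat.add_assoc] using this

theorem append {u v : Word A} {N M : ℕ} (hu : Fills R u N) (hv : Fills R v M) :
    Fills R (u ++ v) (N + M) := by
  simpa using insert_middle (v := []) hv (by simpa using hu)

theorem conj {y : Word A} {N : ℕ} (x : A) (b : Bool) (hy : Fills R y N) :
    Fills R ((x, b) :: (y ++ [(x, !b)])) N := by
  have := insert_middle (u := [(x, b)]) (v := [(x, !b)]) hy (Fills.cancel [] [] x b (.nil 0))
  simpa using this

theorem conj' {y : Word A} {N : ℕ} (x : A) (b : Bool) (hy : Fills R y N) :
    Fills R ((x, !b) :: (y ++ [(x, b)])) N := by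
  simpa using hy.conj x (!b)

theorem rotate {u v : Word A} {N : ℕ} (h : Fills R (u ++ v) N) : Fills R (v ++ u) N := by
  generalize hw : u ++ v = w at h
  induction h generalizing u v with
  | nil N =>
    obtain ⟨rfl, rfl⟩ := List.append_eq_nil_iff.1 hw
    exact .nil N
  | cancel p q x b _ ih =>
    rcases List.append_eq_append_iff.1 hw with ⟨t, rfl, rfl⟩ | ⟨t, rfl, ht⟩
    · have := Fills.cancel t (q ++ u) x b (by simpa using ih (u := u) (v := t ++ q) (by simp))
      simpa using this
    · match t, ht with
      | [], ht =>
        simp only [List.nil_append] at ht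
        subst ht
        have := Fills.cancel [] (q ++ p) x b (by simpa using ih rfl)
        simpa using this
      | [c], ht =>
        simp only [List.cons_append, List.nil_append, List.cons.injEq] at ht
        obtain ⟨rfl, rfl⟩ := ht
        simpa using (ih (u := p) (v := q) rfl).conj' x b
      | c :: d :: t, ht =>
        simp only [List.cons_append, List.cons.injEq] at ht
        obtain ⟨rfl, rfl, rfl⟩ := ht
        have := Fills.cancel (v ++ p) t x b
          (by simpa using ih (u := p ++ t) (v := v) (by simp))
        simpa using this
  | insert p z q hz _ ih =>
    rcases List.append_eq_append_iff.1 hw with ⟨t, rfl, rfl⟩ | ⟨t, rfl, rfl⟩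
    · have := Fills.insert t z (q ++ u) hz
        (by simpa using ih (u := u) (v := t ++ (z ++ q)) (by simp))
      simpa using this
    · have := Fills.insert (v ++ p) z t hz
        (by simpa using ih (u := p ++ (z ++ t)) (v := v) (by simp))
      simpa using this

end Fills

/-- How the letter `(x, b)` followed by `w` can be filled: either the letter is matched with an
inverse letter of `w`, or it lies on a relator. -/
def Splits (R : Set (Word A)) (x : A) (b : Bool) (w : Word A) (N : ℕ) : Prop :=
  (∃ s t N₁ N₂, w = s ++ (x, !b) :: t ∧ N₁ + N₂ ≤ N ∧ Fills R s N₁ ∧ Fills R t N₂) ∨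
    ∃ z M, M + 1 ≤ N ∧ IsRel R ((x, !b) :: z) ∧ Fills R (z ++ w) M

namespace Splits

variable {R : Set (Word A)} {x : A} {b : Bool}

theorem cancel {u v : Word A} {N : ℕ} (y : A) (c : Bool) (h : Splits R x b (u ++ v) N) :
    Splits R x b (u ++ (y, c) :: (y, !c) :: v) N := by
  rcases h with ⟨s, t, N₁, N₂, hw, hN, hs, ht⟩ | ⟨z, M, hM, hz, h⟩
  · left
    rcases List.append_eq_append_iff.1 hw with ⟨k, rfl, rfl⟩ | ⟨k, rfl, hk⟩
    · exact ⟨u ++ (y, c) :: (y, !c) :: k, t, N₁, N₂, by simp, hN, hs.cancel u k y c, ht⟩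
    · match k, hk with
      | [], hk =>
        simp only [List.nil_append] at hk
        subst hk
        exact ⟨s ++ (y, c) :: (y, !c) :: [], t, N₁, N₂, by simp, hN,
          .cancel s [] y c (by simpa using hs), ht⟩
      | d :: k, hk =>
        simp only [List.cons_append, List.cons.injEq] at hk
        obtain ⟨rfl, rfl⟩ := hk
        exact ⟨s, k ++ (y, c) :: (y, !c) :: v, N₁, N₂, by simp, hN, hs, ht.cancel k v y c⟩
  · refine Or.inr ⟨z, M, hM, hz, ?_⟩
    have := Fills.cancel (z ++ u) v y c (by simpa using h)
    simpa using this

theorem insert {u z v : Word A} {N : ℕ} (hz : IsRel R z) (h : Splits R x b (u ++ (z ++ v)) N) :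
    Splits R x b (u ++ v) (N + 1) := by
  rcases h with ⟨s, t, N₁, N₂, hw, hN, hs, ht⟩ | ⟨z', M, hM, hz', h⟩
  · rcases List.append_eq_append_iff.1 hw with ⟨k, rfl, hk⟩ | ⟨k, rfl, hk⟩
    · rcases List.append_eq_append_iff.1 hk with ⟨m, rfl, rfl⟩ | ⟨m, rfl, hm⟩
      · exact Or.inl ⟨u ++ m, t, N₁ + 1, N₂, by simp, by omega, hs.insert u z m hz, ht⟩
      · match m, hm with
        | [], hm =>
          simp only [List.nil_append] at hm
          subst hm
          exact Or.inl ⟨u, t, N₁ + 1, N₂, by simp, by omega,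
            by simpa using Fills.insert u k [] (by simpa using hz) (by simpa using hs), ht⟩
        | d :: m, hm =>
          simp only [List.cons_append, List.cons.injEq] at hm
          obtain ⟨rfl, rfl⟩ := hm
          refine Or.inr ⟨m ++ k, N, le_rfl, by simpa using hz.rotate, ?_⟩
          have := Fills.insert_middle hs.rotate ht
          simpa using this.mono (by omega)
    · match k, hk with
      | [], hk =>
        simp only [List.nil_append] at hk
        match z, hz, hk with
        | [], hz, hk =>
          simp only [List.nil_append] at hk
          subst hk
          exact Or.inl ⟨s, t, N₁, N₂, by simp, by omega, hs, ht⟩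
        | d :: m, hz, hk =>
          simp only [List.cons_append, List.cons.injEq] at hk
          obtain ⟨rfl, rfl⟩ := hk
          refine Or.inr ⟨m, N, le_rfl, hz, ?_⟩
          have := Fills.insert_middle hs ht
          simpa using this.mono (by omega)
      | d :: k, hk =>
        simp only [List.cons_append, List.cons.injEq] at hk
        obtain ⟨rfl, rfl⟩ := hk
        exact Or.inl ⟨s, k ++ v, N₁, N₂ + 1, by simp, by omega, hs, ht.insert k z v hz⟩
  · refine Or.inr ⟨z', M + 1, by omega, hz', ?_⟩
    have := Fills.insert (z' ++ u) z v hz (by simpa using h)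
    simpa using this

end Splits

namespace Fills

variable {R : Set (Word A)}

theorem splits {p q : Word A} {x : A} {b : Bool} {N : ℕ} (h : Fills R (p ++ (x, b) :: q) N) :
    Splits R x b (q ++ p) N := by
  generalize hw : p ++ (x, b) :: q = w at h
  induction h generalizing p q with
  | nil N => simp at hw
  | cancel u v y c h ih =>
    rcases List.append_eq_append_iff.1 hw with ⟨k, rfl, hk⟩ | ⟨k, rfl, hk⟩
    · match k, hk with
      | [], hk =>
        simp only [List.nil_append, List.cons.injEq, Prod.mk.injEq] at hk
        obtain ⟨⟨rfl, rfl⟩, rfl⟩ := hk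
        exact Or.inl ⟨[], v ++ p, 0, _, by simp, (Nat.zero_add _).le, .nil 0,
          by simpa using h.rotate⟩
      | d :: k, hk =>
        simp only [List.cons_append, List.cons.injEq] at hk
        obtain ⟨rfl, rfl⟩ := hk
        have := (ih (p := p) (q := k ++ v) (by simp))
        simpa using Splits.cancel (u := k) (v := v ++ p) y c (by simpa using this)
    · match k, hk with
      | [], hk =>
        simp only [List.nil_append, List.cons.injEq, Prod.mk.injEq] at hk
        obtain ⟨⟨rfl, rfl⟩, rfl⟩ := hk
        exact Or.inl ⟨[], v ++ u, 0, _, by simp, (Nat.zero_add _).le, .nil 0, h.rotate⟩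
      | [d], hk =>
        simp only [List.cons_append, List.nil_append, List.cons.injEq, Prod.mk.injEq] at hk
        obtain ⟨rfl, ⟨rfl, rfl⟩, rfl⟩ := hk
        exact Or.inl ⟨v ++ u, [], _, 0, by simp, (Nat.add_zero _).le, h.rotate, .nil 0⟩
      | d :: e :: k, hk =>
        simp only [List.cons_append, List.cons.injEq] at hk
        obtain ⟨rfl, rfl, rfl⟩ := hk
        have := (ih (p := u ++ k) (q := q) (by simp))
        simpa using Splits.cancel (u := q ++ u) (v := k) y c (by simpa using this)
  | insert u z v hz h ih =>
    rcases List.append_eq_append_iff.1 hw with ⟨k, rfl, hk⟩ | ⟨k, rfl, hk⟩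
    · match k, hk with
      | [], hk =>
        simp only [List.nil_append] at hk
        subst hk
        have := ih (p := p ++ z) (q := q) (by simp)
        simpa using Splits.insert (u := q ++ p) (v := []) hz (by simpa using this)
      | d :: k, hk =>
        simp only [List.cons_append, List.cons.injEq] at hk
        obtain ⟨rfl, rfl⟩ := hk
        have := ih (p := p) (q := k ++ (z ++ v)) (by simp)
        simpa using Splits.insert (u := k) (v := v ++ p) hz (by simpa using this)
    · subst hk
      have := ih (p := u ++ (z ++ k)) (q := q) (by simp)
      simpa using Splits.insert (u := q ++ u) (v := k) hz (by simpa using this)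

theorem of_cancel {u v : Word A} {x : A} {b : Bool} {N : ℕ}
    (h : Fills R (u ++ (x, b) :: (x, !b) :: v) N) : Fills R (u ++ v) N := by
  refine rotate ?_
  rcases h.splits with ⟨s, t, N₁, N₂, hw, hN, hs, ht⟩ | ⟨z, M, hM, hz, h⟩
  · match s, hw, hs with
    | [], hw, hs =>
      simp only [List.cons_append, List.nil_append, List.cons.injEq, true_and] at hw
      subst hw
      exact ht.mono (by omega)
    | d :: s, hw, hs =>
      simp only [List.cons_append, List.cons.injEq] at hw
      obtain ⟨rfl, hw⟩ := hw
      rw [hw]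
      have := (rotate (u := [(x, !b)]) (v := s) hs).append ht
      simpa using this.mono hN
  · have := Fills.insert [] (z ++ [(x, !b)]) (v ++ u)
      (IsRel.rotate (u := [(x, !b)]) hz) (by simpa using h)
    exact this.mono hM

theorem red_iff {w w' : Word A} {N : ℕ} (h : FreeGroup.Red w w') :
    Fills R w N ↔ Fills R w' N := by
  induction h with
  | refl => rfl
  | tail _ h ih =>
    rw [ih]
    cases h
    exact ⟨of_cancel, .cancel _ _ _ _⟩

theorem of_mk_eq {w w' : Word A} {N : ℕ} (h : FreeGroup.mk w = FreeGroup.mk w')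
    (hw : Fills R w N) : Fills R w' N := by
  obtain ⟨d, h1, h2⟩ := FreeGroup.Red.exact.1 h
  exact (red_iff h2).2 ((red_iff h1).1 hw)

theorem conj_word {y : Word A} {N : ℕ} (c : Word A) (hy : Fills R y N) :
    Fills R (c ++ (y ++ inv c)) N := by
  induction c with
  | nil => simpa using hy
  | cons a c ih =>
    obtain ⟨x, b⟩ := a
    simpa [inv_cons] using ih.conj x b

theorem append_inv (w : Word A) : Fills R (w ++ inv w) 0 := by
  simpa using conj_word w (Fills.nil (R := R) 0)

theorem of_isRel {z : Word A} (hz : IsRel R z) : Fills R z 1 := by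
  simpa using Fills.insert z (inv z) [] hz.inv (by simpa using append_inv z)

theorem exists_of_isConjRelator {g : FreeGroup A} (h : IsConjRelator R g) :
    ∃ w, FreeGroup.mk w = g ∧ Fills R w 1 := by
  obtain ⟨c, ρ, hρ, rfl⟩ := h
  obtain ⟨r, hr, rfl⟩ : ∃ r, IsRel R r ∧ FreeGroup.mk r = ρ := by
    rcases hρ with ⟨r, hr, rfl⟩ | ⟨r, hr, h⟩
    · exact ⟨r, isRel_of_mem hr, rfl⟩
    · refine ⟨inv r, (isRel_of_mem hr).inv, ?_⟩
      rw [inv_eq_invRev, ← FreeGroup.inv_mk, h, _root_.inv_inv]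
  obtain ⟨c, rfl⟩ := Quot.exists_rep c
  refine ⟨c ++ (r ++ inv c), ?_, (of_isRel hr).conj_word c⟩
  change _ = FreeGroup.mk c * FreeGroup.mk r * (FreeGroup.mk c)⁻¹
  rw [FreeGroup.inv_mk, FreeGroup.mul_mk, FreeGroup.mul_mk, List.append_assoc, inv_eq_invRev]

theorem exists_of_prod (l : List (FreeGroup A)) (h : ∀ x ∈ l, IsConjRelator R x) :
    ∃ w, FreeGroup.mk w = l.prod ∧ Fills R w l.length := by
  induction l with
  | nil => exact ⟨[], rfl, .nil 0⟩
  | cons g l ih =>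
    obtain ⟨w, hw, hf⟩ := ih fun x hx => h x (List.mem_cons_of_mem _ hx)
    obtain ⟨v, hv, hg⟩ := exists_of_isConjRelator (h g List.mem_cons_self)
    refine ⟨v ++ w, by rw [← FreeGroup.mul_mk, hv, hw, List.prod_cons], ?_⟩
    exact (hg.append hf).mono (by simp [Nat.add_comm])

end Fills

end Word

theorem FLle.nil {A : Type*} (R : Set (Word A)) (L : ℕ) : FLle R [] L :=
  ⟨0, fun _ => [], rfl, rfl, by simp, by simp⟩

theorem FLle.of_move {A : Type*} {R : Set (Word A)} {w w' : Word A} {L : ℕ}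
    (hm : Move R w w') (hw : w.length ≤ L) (h : FLle R w' L) : FLle R w L := by
  obtain ⟨m, f, h0, h1, h2, h3⟩ := h
  refine ⟨m + 1, fun i => Nat.casesOn i w f, rfl, h1, ?_, ?_⟩
  · rintro (_ | i) hi
    · simpa [h0] using hm
    · exact h2 i (by omega)
  · rintro (_ | i) hi
    · exact hw
    · exact h3 i (by omega)

theorem Word.Fills.fLle {A : Type*} {R : Set (Word A)} {K : ℕ} (hK : ∀ r ∈ R, r.length ≤ K)
    {w : Word A} {N L : ℕ} (h : Word.Fills R w N) (hL : K * N + w.length ≤ L) : FLle R w L := by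
  induction h with
  | nil N => exact .nil R L
  | cancel u v x b _ ih =>
    refine .of_move (.freeReduce u v x b) (by omega) (ih ?_)
    simp only [List.length_append, List.length_cons] at hL ⊢
    omega
  | insert u z v hz _ ih =>
    obtain ⟨r, hc, hr⟩ := hz.inv
    have hlen : z.length ≤ K := by
      have hzr : z.length = r.length := by
        obtain ⟨p, q, h1, rfl⟩ := hc
        rw [← Word.length_inv z, h1]
        simp [Nat.add_comm]
      rcases hr with hr | hr
      · exact hzr.trans_le (hK _ hr)
      · rw [hzr, ← Word.length_inv r]
        exact hK _ hr
    have hm := Move.relator (R := R) u v [] z r (by simpa using hc) hr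
    refine .of_move (by simpa using hm) (by omega) (ih ?_)
    simp only [List.length_append, Nat.mul_succ] at hL ⊢
    omega

theorem FL_le_area {A : Type*} [Finite A] (R : Set (Word A)) (hR : R.Finite) :
    ∃ C : ℕ, 0 < C ∧ ∀ (w : Word A) (N : ℕ) (l : List (FreeGroup A)),
      l.length = N → (∀ x ∈ l, IsConjRelator R x) → l.prod = FreeGroup.mk w →
      FLle R w (C * N + w.length) := by
  obtain ⟨K, hK⟩ := (hR.image List.length).bddAbove
  refine ⟨K + 1, K.succ_pos, ?_⟩
  rintro w _ l rfl hl hw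
  obtain ⟨v, hv, hf⟩ := Word.Fills.exists_of_prod l hl
  exact (hf.of_mk_eq (hv.trans hw)).fLle
    (fun r hr => (hK ⟨r, hr, rfl⟩).trans K.le_succ) le_rfl
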